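/- Let M be a finite functional causal model on a directed graph G = (V,E), let G^s ∈ F(G) be a classical teleportation graph with split vertex set S, and let M^s be a teleportation fCM on G^s constructed from M, where the teleportation protocol at split vertex v has success probability λ_v. Then the post-selection success probability satisfies P_succ = (Π_{v∈S} λ_v) · N̄, where N̄ is the average number of solutions of M. -/

import Mathlib

open Finset

noncomputable section

/-- The Kronecker delta `δ_{x,y}` as a real number: `1` if `x = y` and `0` otherwise. -/
def kron {α : Type*} (x y : α) : ℝ := by
  classical exact if x = y then 1 else 0

/-- A probability distribution on a finite type: values in `[0,1]` summing to `1`. -/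
def IsProbDist {α : Type*} [Fintype α] (p : α → ℝ) : Prop :=
  (∀ a, 0 ≤ p a ∧ p a ≤ 1) ∧ ∑ a, p a = 1

/-- A directed graph (vertex type `V`, edge relation `E`) is acyclic if it contains no
directed cycle. -/
def Acyclic {V : Type*} (E : V → V → Prop) : Prop :=
  ∀ v, ¬ Relation.TransGen E v v

/-- A finite functional causal model (fCM) on a directed graph `G = (V, E)` with finite
vertex set: each vertex `v` carries a nonempty finite set `X v` of values, a finite set
`U v` of error values with a probability distribution `pU v`, and a function
`f v : X_{pa(v)} × U_v → X_v` (the dependence on the parents `pa(v) = {w : E w v}` is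
encoded by giving `f v` access to the values of all `w` with `E w v`). -/
structure FCM (V : Type) [Fintype V] [DecidableEq V] (E : V → V → Prop) where
  X : V → Type
  fintX : ∀ v, Fintype (X v)
  neX : ∀ v, Nonempty (X v)
  U : V → Type
  fintU : ∀ v, Fintype (U v)
  pU : ∀ v, U v → ℝ
  pU_mem : ∀ v u, 0 ≤ pU v u ∧ pU v u ≤ 1
  pU_sum : ∀ v, letI := fintU v; (∑ u, pU v u) = 1
  f : ∀ v, (∀ w, E w v → X w) → U v → X v

attribute [instance] FCM.fintX FCM.neX FCM.fintU

variable {V : Type} [Fintype V] [DecidableEq V] {E : V → V → Prop}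

/-- The number of solutions `N(u)` of an fCM for a valuation `u` of the error variables. -/
def FCM.Nsol (M : FCM V E) (u : ∀ v, M.U v) : ℝ :=
  ∑ x : ∀ v, M.X v, ∏ v, kron (M.f v (fun w _ => x w) (u v)) (x v)

/-- The average number of solutions `N̄ = Σ_u N(u) Π_v p^v(u_v)` of an fCM. -/
def FCM.Nbar (M : FCM V E) : ℝ :=
  ∑ u : ∀ v, M.U v, M.Nsol u * ∏ v, M.pU v (u v)

/-- The data of a teleportation fCM on the classical teleportation graph `G^s` obtained from
an fCM `M` by splitting the vertices of `S`: for each split vertex `v ∈ S`, the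
pre-selection vertex `R_v` carries the set `X v` with distribution `qC v`, and the
post-selection vertex `T_v` carries the set `{0,1}` with error set `B v` (distributed as
`qB v`) and function `τ v : X v × B v × X v → {0,1}`, such that `(τ v, qB v, qC v)` is a
classical post-selected teleportation protocol with success probability `lam v ∈ (0,1]`. -/
structure TeleProto {V : Type} [Fintype V] [DecidableEq V] {E : V → V → Prop}
    (M : FCM V E) (S : Finset V) where
  B : V → Type
  fintB : ∀ v, Fintype (B v)
  qB : ∀ v, B v → ℝ
  qC : ∀ v, M.X v → ℝ
  tau : ∀ v, M.X v → B v → M.X v → Fin 2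
  lam : V → ℝ
  qB_dist : ∀ v ∈ S, letI := fintB v; IsProbDist (qB v)
  qC_dist : ∀ v ∈ S, IsProbDist (qC v)
  lam_mem : ∀ v ∈ S, 0 < lam v ∧ lam v ≤ 1
  proto : ∀ v ∈ S, ∀ p : M.X v → ℝ, IsProbDist p → ∀ c : M.X v,
    letI := fintB v;
    (∑ a, ∑ b, p a * kron (tau v a b c) 1 * qB v b * qC v c) = lam v * p c

attribute [instance] TeleProto.fintB

/-- The input to the functions of the teleportation fCM: for each split vertex `w ∈ S`, the
pre-selection vertex `R_w` (with value `r w`) substitutes `w` as input to the functions of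
the children of `w`. -/
def teleArg (M : FCM V E) (S : Finset V)
    (x : ∀ v, M.X v) (r : ∀ v : {w // w ∈ S}, M.X v.1) : ∀ v, M.X v :=
  fun v => if h : v ∈ S then r ⟨v, h⟩ else x v

/-- The acyclic probability rule applied to the teleportation fCM: the joint probability
`P_acyc(x, r, t)_{G^s}` of values `x` on the original vertices, `r` on the pre-selection
vertices and `t` on the post-selection vertices. -/
def telePacyc (M : FCM V E) (S : Finset V) (T : TeleProto M S)
    (x : ∀ v, M.X v) (r : ∀ v : {w // w ∈ S}, M.X v.1)
    (t : {w // w ∈ S} → Fin 2) : ℝ :=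
  ∑ u : ∀ v, M.U v, ∑ b : ∀ v : {w // w ∈ S}, T.B v.1,
    (∏ v, M.pU v (u v) * kron (x v) (M.f v (fun w _ => teleArg M S x r w) (u v))) *
    ∏ v : {w // w ∈ S},
      T.qC v.1 (r v) * T.qB v.1 (b v) * kron (t v) (T.tau v.1 (x v.1) (b v) (r v))

/-- The post-selection success probability
`P_succ = P_acyc({t_{T_v} = 1}_{v ∈ S})_{G^s} = Σ_{x,r} P_acyc(x, r, {t_{T_v} = 1})_{G^s}`. -/
def Psucc (M : FCM V E) (S : Finset V) (T : TeleProto M S) : ℝ :=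
  ∑ x : ∀ v, M.X v, ∑ r : ∀ v : {w // w ∈ S}, M.X v.1,
    telePacyc M S T x r fun _ => 1

/-- The conditional probability `P_acyc(x | {t_T = 1}_{T ∈ 𝒯})_{G^s}` of a joint assignment
`x` on the original vertices given successful post-selection (the pre-selection values being
marginalized). -/
def Pcond (M : FCM V E) (S : Finset V) (T : TeleProto M S) (x : ∀ v, M.X v) : ℝ :=
  (∑ r : ∀ v : {w // w ∈ S}, M.X v.1, telePacyc M S T x r fun _ => 1) / Psucc M S T

theorem kron_self {α : Type*} (x : α) : kron x x = 1 := by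
  simp [kron]

theorem kron_of_ne {α : Type*} {x y : α} (h : x ≠ y) : kron x y = 0 := by
  simp [kron, h]

theorem kron_comm {α : Type*} (x y : α) : kron x y = kron y x := by
  rcases eq_or_ne x y with rfl | h
  · rfl
  · rw [kron_of_ne h, kron_of_ne h.symm]

theorem isProbDist_kron {α : Type*} [Fintype α] (a : α) : IsProbDist (kron a) := by
  classical
  refine ⟨fun b => ?_, by simp [kron]⟩
  rcases eq_or_ne a b with rfl | h
  · simp [kron_self]
  · simp [kron_of_ne h]

/-- A product of Kronecker deltas, one per coordinate, selects a single term of a sum over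
dependent functions. -/
theorem sum_mul_prod_kron {ι : Type*} [Fintype ι] [DecidableEq ι] {α : ι → Type*}
    [∀ i, Fintype (α i)] (g : (∀ i, α i) → ℝ) (x : ∀ i, α i) :
    ∑ r : ∀ i, α i, g r * ∏ i, kron (x i) (r i) = g x := by
  rw [Finset.sum_eq_single x]
  · simp [kron_self]
  · intro r _ hr
    obtain ⟨i, hi⟩ := Function.ne_iff.mp hr
    have hzero : ∏ i, kron (x i) (r i) = 0 :=
      Finset.prod_eq_zero (Finset.mem_univ i) (kron_of_ne hi.symm)
    rw [hzero, mul_zero]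
  · simp

/-- The protocol identity evaluated at a point mass: the probability of preparing `c` and
succeeding on input `a` is `λ_v δ_{a,c}`. -/
theorem TeleProto.sum_success_eq (M : FCM V E) (S : Finset V) (T : TeleProto M S)
    {v : V} (hv : v ∈ S) (a c : M.X v) :
    ∑ b, T.qC v c * T.qB v b * kron 1 (T.tau v a b c) = T.lam v * kron a c := by
  rw [← T.proto v hv (kron a) (isProbDist_kron a) c, Finset.sum_eq_single a]
  · refine Finset.sum_congr rfl fun b _ => ?_
    rw [kron_self, kron_comm 1]
    ring
  · intro a' _ h
    simp [kron_of_ne h.symm]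
  · simp

theorem teleArg_restrict (M : FCM V E) (S : Finset V) (x : ∀ v, M.X v) :
    teleArg M S x (fun v => x v.1) = x := by
  funext v
  simp [teleArg]

/-- Summing out the error values at the post-selection vertices. -/
theorem telePacyc_success_eq (M : FCM V E) (S : Finset V) (T : TeleProto M S)
    (x : ∀ v, M.X v) (r : ∀ v : {w // w ∈ S}, M.X v.1) :
    telePacyc M S T x r (fun _ => 1) =
      ((∏ v ∈ S, T.lam v) * ∑ u : ∀ v, M.U v,
        ∏ v, M.pU v (u v) * kron (x v) (M.f v (fun w _ => teleArg M S x r w) (u v))) *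
      ∏ v : {w // w ∈ S}, kron (x v.1) (r v) := by
  have hprod : ∑ b : ∀ v : {w // w ∈ S}, T.B v.1, ∏ v : {w // w ∈ S},
      T.qC v.1 (r v) * T.qB v.1 (b v) * kron 1 (T.tau v.1 (x v.1) (b v) (r v)) =
      (∏ v ∈ S, T.lam v) * ∏ v : {w // w ∈ S}, kron (x v.1) (r v) := by
    rw [← Fintype.prod_sum (fun (v : {w // w ∈ S}) (b : T.B v.1) =>
        T.qC v.1 (r v) * T.qB v.1 b * kron 1 (T.tau v.1 (x v.1) b (r v))),
      ← Finset.prod_coe_sort S T.lam, ← Finset.prod_mul_distrib]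
    exact Finset.prod_congr rfl fun v _ => T.sum_success_eq M S v.2 _ _
  unfold telePacyc
  simp_rw [← Finset.mul_sum, hprod, ← Finset.sum_mul]
  ring

/-- Let `M` be a finite functional causal model on a directed graph
`G = (V, E)`, let `G^s ∈ F(G)` be a classical teleportation graph with split vertex set `S`
(so that removing all outgoing edges of vertices in `S` yields an acyclic graph), and let
`M^s` be a teleportation fCM on `G^s` constructed from `M`, where the teleportation protocol
at split vertex `v` has success probability `λ_v`.  Then the post-selection success
probability satisfies `P_succ = (Π_{v∈S} λ_v) · N̄`, where `N̄` is the average number of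
solutions of `M`. -/
theorem success_probability_eq_lambda_mul_average_solutions
    {V : Type} [Fintype V] [DecidableEq V] {E : V → V → Prop}
    (M : FCM V E) (S : Finset V)
    (hS : Acyclic fun a b : V => E a b ∧ a ∉ S)
    (T : TeleProto M S) :
    Psucc M S T = (∏ v ∈ S, T.lam v) * M.Nbar := by
  unfold Psucc FCM.Nbar FCM.Nsol
  simp_rw [telePacyc_success_eq]
  have hsum (x : ∀ v, M.X v) := sum_mul_prod_kron
    (fun r : ∀ v : {w // w ∈ S}, M.X v.1 => (∏ v ∈ S, T.lam v) * ∑ u : ∀ v, M.U v,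
      ∏ v, M.pU v (u v) * kron (x v) (M.f v (fun w _ => teleArg M S x r w) (u v)))
    (fun v => x v.1)
  simp_rw [hsum, teleArg_restrict, ← Finset.mul_sum, Finset.sum_mul]
  rw [Finset.sum_comm]
  congr 1
  refine Finset.sum_congr rfl fun u _ => Finset.sum_congr rfl fun x _ => ?_
  rw [Finset.prod_mul_distrib, mul_comm]
  simp_rw [kron_comm (x _)]
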